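/- Let H(x) := ∫₀ˣ (1−t²)^{−5/6} dt for x ∈ [0,1]. For every s ∈ [0,1], set y := √( 1 − ( (9 − 8s² − 4s²(1−s²)^{1/3}) / (9 − 8s² + 8s²(1−s²)^{1/3}) )³ ). If 2H(s) ≤ H(1), then H(y) = 2H(s); if 2H(s) ≥ H(1), then H(y) = 2H(1) − 2H(s). (This is the double-angle formula for sin_{6/5,2}: for x ∈ [0, π_{6/5,2}/2], sin_{6/5,2}(2x) = √(1 − ((9 − 8 sin² − 4 sin² cos^{2/5})/(9 − 8 sin² + 8 sin² cos^{2/5}))³), since cos_{6/5,2}^{2/5} x = (1 − sin_{6/5,2}² x)^{1/3}.) -/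

import Mathlib

/-- `H = F_{6/5,2}`, the incomplete integral `∫₀ˣ (1−t²)^{−5/6} dt`. -/
noncomputable def H652 (x : ℝ) : ℝ := ∫ t in (0:ℝ)..x, (1 - t ^ 2) ^ (-(5/6) : ℝ)

open Set MeasureTheory

lemma H_integrable : IntervalIntegrable (fun t : ℝ => (1 - t ^ 2) ^ (-(5/6) : ℝ)) volume 0 1 := by
  have h1 : IntervalIntegrable (fun t : ℝ => t ^ (-(5/6) : ℝ)) volume 1 0 :=
    intervalIntegral.intervalIntegrable_rpow' (by norm_num)
  have h2 : IntervalIntegrable (fun t : ℝ => (1 - t) ^ (-(5/6) : ℝ)) volume 0 1 := by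
    have := h1.comp_sub_left 1
    simpa using this
  refine h2.mono_fun ?_ ?_
  · apply Measurable.aestronglyMeasurable
    fun_prop
  · rw [Filter.EventuallyLE, ae_restrict_iff' measurableSet_uIoc]
    refine Filter.Eventually.of_forall fun t ht => ?_
    rw [uIoc_of_le zero_le_one] at ht
    obtain ⟨h0, h1⟩ := ht
    have ha : 0 ≤ 1 - t := by linarith
    have hb : 1 - t ≤ 1 - t ^ 2 := by nlinarith
    rw [Real.norm_of_nonneg (Real.rpow_nonneg (ha.trans hb) _),
      Real.norm_of_nonneg (Real.rpow_nonneg ha _)]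
    rcases eq_or_lt_of_le h1 with h | h
    · subst h; norm_num
    · exact Real.rpow_le_rpow_of_nonpos (by linarith) hb (by norm_num)

lemma H_cont : ContinuousOn H652 (Icc 0 1) := by
  have h := intervalIntegral.continuousOn_primitive_interval'
    (a := 0) H_integrable (by simp)
  rw [uIcc_of_le zero_le_one] at h
  exact h

lemma H_deriv {x : ℝ} (h0 : 0 ≤ x) (h1 : x < 1) :
    HasDerivAt H652 ((1 - x ^ 2) ^ (-(5/6) : ℝ)) x := by
  have hpos : 0 < 1 - x ^ 2 := by nlinarith
  refine intervalIntegral.integral_hasDerivAt_right (f := fun t : ℝ => (1 - t ^ 2) ^ (-(5/6) : ℝ))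
    ?_ ?_ ?_
  · refine H_integrable.mono_set ?_
    rw [uIcc_of_le h0, uIcc_of_le zero_le_one]
    exact Icc_subset_Icc_right h1.le
  · refine Measurable.stronglyMeasurable ?_ |>.stronglyMeasurableAtFilter
    fun_prop
  · exact ContinuousAt.rpow_const (by fun_prop) (Or.inl hpos.ne')

/-- `H` in terms of `c = (1-s^2)^{1/3}`. -/
noncomputable def K652 (c : ℝ) : ℝ := H652 (Real.sqrt (1 - c ^ 3))

lemma K_cont : ContinuousOn K652 (Icc 0 1) := by
  refine H_cont.comp (by fun_prop) ?_
  intro c hc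
  have : 0 ≤ c ^ 3 := pow_nonneg hc.1 3
  exact ⟨Real.sqrt_nonneg _, Real.sqrt_le_one.2 (by linarith)⟩

lemma K_deriv {c : ℝ} (h0 : 0 < c) (h1 : c < 1) :
    HasDerivAt K652 (-(3/2) / Real.sqrt (c * (1 - c ^ 3))) c := by
  have hc3 : 0 < c ^ 3 := pow_pos h0 3
  have hc3' : c ^ 3 < 1 := pow_lt_one₀ h0.le h1 (by norm_num)
  have hp : 0 < 1 - c ^ 3 := by linarith
  have hd : HasDerivAt (fun c : ℝ => Real.sqrt (1 - c ^ 3))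
      ((-(3 * c ^ 2)) / (2 * Real.sqrt (1 - c ^ 3))) c := by
    refine HasDerivAt.sqrt ?_ hp.ne'
    simpa using (hasDerivAt_pow 3 c).const_sub 1
  have hlt : Real.sqrt (1 - c ^ 3) < 1 := by
    rw [Real.sqrt_lt' one_pos]; linarith
  have := (H_deriv (Real.sqrt_nonneg _) hlt).comp c hd
  refine this.congr_deriv ?_
  rw [Real.sq_sqrt hp.le, Real.sqrt_mul h0.le]
  have e : (1 - (1 - c ^ 3)) ^ (-(5/6) : ℝ) = (c ^ 2 * Real.sqrt c)⁻¹ := by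
    rw [sub_sub_cancel, Real.sqrt_eq_rpow, ← Real.rpow_natCast, ← Real.rpow_natCast,
      ← Real.rpow_mul h0.le, ← Real.rpow_add h0, ← Real.rpow_neg h0.le]
    norm_num
  rw [e]
  have : 0 < Real.sqrt c := Real.sqrt_pos.2 h0
  have : 0 < Real.sqrt (1 - c ^ 3) := Real.sqrt_pos.2 hp
  field_simp

lemma K_anti : StrictAntiOn K652 (Icc 0 1) := by
  refine strictAntiOn_of_deriv_neg (convex_Icc 0 1) K_cont ?_
  intro c hc
  rw [interior_Icc] at hc
  rw [(K_deriv hc.1 hc.2).deriv]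
  have hc3' : c ^ 3 < 1 := pow_lt_one₀ hc.1.le hc.2 (by norm_num)
  have : 0 < c * (1 - c ^ 3) := mul_pos hc.1 (by linarith)
  have := Real.sqrt_pos.2 this
  exact div_neg_of_neg_of_pos (by norm_num) this

noncomputable def wP (c : ℝ) : ℝ := 1 - 2 * c - 2 * c ^ 2
noncomputable def dP (c : ℝ) : ℝ := 1 + 8 * c + 8 * c ^ 3 - 8 * c ^ 4
noncomputable def qP (c : ℝ) : ℝ := 1 + 2 * c + 6 * c ^ 2 - 4 * c ^ 3 + 4 * c ^ 4
noncomputable def rP (c : ℝ) : ℝ := wP c ^ 2 / dP c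

lemma dP_pos {c : ℝ} (hc : c ∈ Icc (0:ℝ) 1) : 0 < dP c := by
  have : 0 ≤ c ^ 3 := pow_nonneg hc.1 3
  have : c ^ 3 ≤ 1 := pow_le_one₀ hc.1 hc.2
  have : 0 ≤ c * (1 - c ^ 3) := mul_nonneg hc.1 (by linarith)
  unfold dP; nlinarith

lemma qP_pos {c : ℝ} : 0 < qP c := by
  have : qP c = (2 * c ^ 2 - c) ^ 2 + (c + 1) ^ 2 + 4 * c ^ 2 := by unfold qP; ring
  rw [this]
  rcases eq_or_ne c 0 with rfl | h
  · norm_num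
  · positivity

lemma rP_mem {c : ℝ} (hc : c ∈ Icc (0:ℝ) 1) : rP c ∈ Icc (0:ℝ) 1 := by
  have hd := dP_pos hc
  have : c ^ 3 ≤ 1 := pow_le_one₀ hc.1 hc.2
  have : 0 ≤ c * (1 - c ^ 3) := mul_nonneg hc.1 (by linarith)
  refine ⟨div_nonneg (sq_nonneg _) hd.le, ?_⟩
  unfold rP
  rw [div_le_one hd]
  unfold dP wP; nlinarith

lemma rP_cont : ContinuousOn rP (Icc 0 1) := by
  unfold rP
  refine ContinuousOn.div ?_ ?_ fun c hc => (dP_pos hc).ne'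
  · unfold wP; fun_prop
  · unfold dP; fun_prop

lemma rP_deriv {c : ℝ} (hc : c ∈ Icc (0:ℝ) 1) :
    HasDerivAt rP (-12 * wP c * qP c / dP c ^ 2) c := by
  have hw : HasDerivAt wP (-2 - 4 * c) c := by
    have h := (((hasDerivAt_id c).const_mul 2).const_sub 1).sub ((hasDerivAt_pow 2 c).const_mul 2)
    refine h.congr_deriv ?_
    simp; ring
  have hd : HasDerivAt dP (8 + 24 * c ^ 2 - 32 * c ^ 3) c := by
    have h := ((((hasDerivAt_id c).const_mul 8).const_add 1).add
      ((hasDerivAt_pow 3 c).const_mul 8)).sub ((hasDerivAt_pow 4 c).const_mul 8)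
    refine h.congr_deriv ?_
    simp; ring
  refine ((hw.pow 2).div hd (dP_pos hc).ne').congr_deriv ?_
  congr 1
  simp only [Pi.pow_apply]
  unfold wP dP qP
  push_cast
  ring

lemma rP_alg {c : ℝ} (hc : c ∈ Icc (0:ℝ) 1) :
    rP c * (1 - rP c ^ 3) = (6 * wP c * qP c / dP c ^ 2) ^ 2 * (c * (1 - c ^ 3)) := by
  have hd := (dP_pos hc).ne'
  have key : dP c ^ 3 - (wP c ^ 2) ^ 3 = 36 * qP c ^ 2 * (c * (1 - c ^ 3)) := by
    unfold wP dP qP; ring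
  unfold rP
  have : wP c ^ 2 / dP c * (1 - (wP c ^ 2 / dP c) ^ 3)
      = wP c ^ 2 * (dP c ^ 3 - (wP c ^ 2) ^ 3) / dP c ^ 4 := by
    field_simp
  rw [this, key]
  field_simp
  ring

lemma KR_deriv {c : ℝ} (h0 : 0 < c) (h1 : c < 1) (hw : wP c ≠ 0) :
    HasDerivAt (fun c => K652 (rP c))
      ((-(3/2) / (|6 * wP c * qP c / dP c ^ 2| * Real.sqrt (c * (1 - c ^ 3)))) *
        (-12 * wP c * qP c / dP c ^ 2)) c := by
  have hc : c ∈ Icc (0:ℝ) 1 := ⟨h0.le, h1.le⟩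
  have hc3' : c ^ 3 < 1 := pow_lt_one₀ h0.le h1 (by norm_num)
  have hd := dP_pos hc
  have hpos : 0 < rP c * (1 - rP c ^ 3) := by
    rw [rP_alg hc]
    have : 0 < c * (1 - c ^ 3) := mul_pos h0 (by linarith)
    have := (qP_pos (c := c)).ne'
    have := hd.ne'
    positivity
  have hr0 : 0 < rP c := by
    rcases eq_or_lt_of_le (rP_mem hc).1 with h | h
    · rw [← h] at hpos; simp at hpos
    · exact h
  have hr1 : rP c < 1 := by
    rcases eq_or_lt_of_le (rP_mem hc).2 with h | h
    · rw [h] at hpos; simp at hpos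
    · exact h
  have h := (K_deriv hr0 hr1).comp c (rP_deriv hc)
  rw [rP_alg hc, Real.sqrt_mul (sq_nonneg _), Real.sqrt_sq_eq_abs] at h
  exact h

lemma KR_cont : ContinuousOn (fun c => K652 (rP c)) (Icc 0 1) :=
  K_cont.comp rP_cont fun _ hc => rP_mem hc

lemma const_of_deriv {f : ℝ → ℝ} {a b : ℝ} (hf : ContinuousOn f (Icc a b))
    (hd : ∀ x ∈ Ioo a b, HasDerivAt f 0 x) {x : ℝ} {y : ℝ}
    (hx : x ∈ Icc a b) (hy : y ∈ Icc a b) : f x = f y := by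
  have hm : MonotoneOn f (Icc a b) := by
    refine monotoneOn_of_deriv_nonneg (convex_Icc a b) hf ?_ ?_
    · intro z hz; rw [interior_Icc] at hz
      exact (hd z hz).differentiableAt.differentiableWithinAt
    · intro z hz; rw [interior_Icc] at hz; rw [(hd z hz).deriv]
  have ha : AntitoneOn f (Icc a b) := by
    refine antitoneOn_of_deriv_nonpos (convex_Icc a b) hf ?_ ?_
    · intro z hz; rw [interior_Icc] at hz
      exact (hd z hz).differentiableAt.differentiableWithinAt
    · intro z hz; rw [interior_Icc] at hz; rw [(hd z hz).deriv]
  rcases le_total x y with h | h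
  · exact le_antisymm (hm hx hy h) (ha hx hy h)
  · exact le_antisymm (ha hy hx h) (hm hy hx h)

noncomputable def c0 : ℝ := (Real.sqrt 3 - 1) / 2

lemma c0_mem : c0 ∈ Ioo (0:ℝ) 1 := by
  have h := Real.sq_sqrt (show (0:ℝ) ≤ 3 by norm_num)
  have h0 := Real.sqrt_nonneg 3
  unfold c0
  constructor <;> nlinarith

lemma wP_eq (c : ℝ) : wP c = 2 * (c0 - c) * (c + c0 + 1) := by
  have h := Real.sq_sqrt (show (0:ℝ) ≤ 3 by norm_num)
  unfold wP c0
  linear_combination -h / 2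

lemma K_one : K652 1 = 0 := by simp [K652, H652]

lemma K_double_high {c : ℝ} (hc : c ∈ Icc c0 1) : K652 (rP c) = 2 * K652 c := by
  have h0 := c0_mem
  have hsub : Icc c0 1 ⊆ Icc (0:ℝ) 1 := Icc_subset_Icc_left h0.1.le
  have h := const_of_deriv (f := fun c => K652 (rP c) - 2 * K652 c) (a := c0) (b := 1)
    ((KR_cont.mono hsub).sub ((K_cont.mono hsub).const_mul 2)) ?_ hc ⟨h0.2.le, le_rfl⟩
  · have hr : rP 1 = 1 := by norm_num [rP, wP, dP]
    simp only [hr, K_one] at h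
    linarith
  · intro x hx
    have hx0 : 0 < x := h0.1.trans hx.1
    have hw : wP x < 0 := by
      rw [wP_eq]
      exact mul_neg_of_neg_of_pos (by linarith [hx.1]) (by linarith [h0.1])
    have hd := dP_pos (c := x) ⟨hx0.le, hx.2.le⟩
    have hq := qP_pos (c := x)
    refine ((KR_deriv hx0 hx.2 hw.ne).sub ((K_deriv hx0 hx.2).const_mul 2)).congr_deriv ?_
    have hneg : 6 * wP x * qP x / dP x ^ 2 < 0 :=
      div_neg_of_neg_of_pos (by nlinarith) (by positivity)
    rw [abs_of_neg hneg]
    have hx3 : x ^ 3 < 1 := pow_lt_one₀ hx0.le hx.2 (by norm_num)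
    have : 0 < Real.sqrt (x * (1 - x ^ 3)) := Real.sqrt_pos.2 (mul_pos hx0 (by linarith))
    have := hw.ne
    field_simp
    ring

lemma K_double_low {c : ℝ} (hc : c ∈ Icc 0 c0) : K652 (rP c) = 2 * K652 0 - 2 * K652 c := by
  have h0 := c0_mem
  have hsub : Icc 0 c0 ⊆ Icc (0:ℝ) 1 := Icc_subset_Icc_right h0.2.le
  have h := const_of_deriv (f := fun c => K652 (rP c) + 2 * K652 c) (a := 0) (b := c0)
    ((KR_cont.mono hsub).add ((K_cont.mono hsub).const_mul 2)) ?_ hc ⟨le_rfl, h0.1.le⟩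
  · have hr : rP 0 = 1 := by norm_num [rP, wP, dP]
    simp only [hr, K_one] at h
    linarith
  · intro x hx
    have hx0 : 0 < x := hx.1
    have hx1 : x < 1 := hx.2.trans h0.2
    have hw : 0 < wP x := by
      rw [wP_eq]
      exact mul_pos (by linarith [hx.2]) (by linarith [h0.1])
    have hd := dP_pos (c := x) ⟨hx0.le, hx1.le⟩
    have hq := qP_pos (c := x)
    refine ((KR_deriv hx0 hx1 hw.ne').add ((K_deriv hx0 hx1).const_mul 2)).congr_deriv ?_
    have hpos : 0 < 6 * wP x * qP x / dP x ^ 2 := by positivity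
    rw [abs_of_pos hpos]
    have hx3 : x ^ 3 < 1 := pow_lt_one₀ hx0.le hx1 (by norm_num)
    have : 0 < Real.sqrt (x * (1 - x ^ 3)) := Real.sqrt_pos.2 (mul_pos hx0 (by linarith))
    field_simp
    ring

lemma K_c0 : 2 * K652 c0 = K652 0 := by
  have h1 := K_double_high (c := c0) ⟨le_rfl, c0_mem.2.le⟩
  have hr : rP c0 = 0 := by simp [rP, wP_eq]
  rw [hr] at h1
  exact h1.symm

/-- The double-angle formula for `sin_{6/5,2}`. -/
theorem double_angle_sin_six_fifths_two (s : ℝ) (hs : s ∈ Set.Icc (0:ℝ) 1) :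
    (2 * H652 s ≤ H652 1 →
      H652 (Real.sqrt (1 -
          ((9 - 8 * s ^ 2 - 4 * s ^ 2 * (1 - s ^ 2) ^ ((1:ℝ)/3))
            / (9 - 8 * s ^ 2 + 8 * s ^ 2 * (1 - s ^ 2) ^ ((1:ℝ)/3))) ^ 3))
        = 2 * H652 s) ∧
    (H652 1 ≤ 2 * H652 s →
      H652 (Real.sqrt (1 -
          ((9 - 8 * s ^ 2 - 4 * s ^ 2 * (1 - s ^ 2) ^ ((1:ℝ)/3))
            / (9 - 8 * s ^ 2 + 8 * s ^ 2 * (1 - s ^ 2) ^ ((1:ℝ)/3))) ^ 3))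
        = 2 * H652 1 - 2 * H652 s) := by
  obtain ⟨hs0, hs1⟩ := hs
  have hp : 0 ≤ 1 - s ^ 2 := by nlinarith
  obtain ⟨c, hcdef⟩ : ∃ c, c = (1 - s ^ 2) ^ ((1:ℝ)/3) := ⟨_, rfl⟩
  rw [← hcdef]
  have hc0 : 0 ≤ c := hcdef ▸ Real.rpow_nonneg hp _
  have hc1 : c ≤ 1 := hcdef ▸ Real.rpow_le_one hp (by nlinarith) (by norm_num)
  have hc3 : c ^ 3 = 1 - s ^ 2 := by
    rw [hcdef, ← Real.rpow_natCast, ← Real.rpow_mul hp]; norm_num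
  have hs2 : s ^ 2 = 1 - c ^ 3 := by linarith
  have hHs : H652 s = K652 c := by
    rw [K652, ← hs2, Real.sqrt_sq hs0]
  have hH1 : H652 1 = K652 0 := by simp [K652]
  have hR : (9 - 8 * s ^ 2 - 4 * s ^ 2 * c) / (9 - 8 * s ^ 2 + 8 * s ^ 2 * c) = rP c := by
    rw [hs2]; unfold rP wP dP
    congr 1 <;> ring
  rw [hR, hHs, hH1, ← K_c0]
  change (_ → K652 (rP c) = _) ∧ (_ → K652 (rP c) = _)
  have hcm : c ∈ Icc (0:ℝ) 1 := ⟨hc0, hc1⟩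
  have h0m : c0 ∈ Icc (0:ℝ) 1 := ⟨c0_mem.1.le, c0_mem.2.le⟩
  constructor
  · intro h
    exact K_double_high ⟨(K_anti.le_iff_ge hcm h0m).1 (by linarith), hc1⟩
  · intro h
    rw [K_c0]
    exact K_double_low ⟨hc0, (K_anti.le_iff_ge h0m hcm).1 (by linarith)⟩
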